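/- Let X be a Gamma-distributed real random variable with shape α > 0 and rate κ > 0, and let a > 0. Then E[exp(−a·X²)] = (κ^α/(2Γ(α)))·a^{−α/2}·[ Γ(α/2)·₁F₁(α/2; 1/2; κ²/(4a)) − (κ/√a)·Γ((α+1)/2)·₁F₁((α+1)/2; 3/2; κ²/(4a)) ]. (With α = N−K+1 and κ = K this is the expectation computed in the constructive-interference sum-rate theorem.) -/

import Mathlib

open MeasureTheory Real

/-- The confluent hypergeometric series `₁F₁(a; b; z) = ∑ₘ ((a)ₘ/(b)ₘ) zᵐ/m!`, where
`(x)ₘ` is the ascending Pochhammer symbol. -/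
noncomputable def oneFOne (a b z : ℝ) : ℝ :=
  ∑' m : ℕ,
    (Polynomial.eval a (ascPochhammer ℝ m) / Polynomial.eval b (ascPochhammer ℝ m)) *
      z ^ m / (Nat.factorial m : ℝ)

lemma Gamma_add_nat_eq_ascPochhammer {s : ℝ} (hs : 0 < s) (m : ℕ) :
    Real.Gamma (s + m) = (ascPochhammer ℝ m).eval s * Real.Gamma s := by
  induction m with
  | zero => simp
  | succ m ih =>
    rw [ascPochhammer_succ_eval, Nat.cast_succ, ← add_assoc,
      Real.Gamma_add_one (by positivity), ih]
    ring

lemma factorial_two_mul_eq_ascPochhammer (m : ℕ) :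
    ((2 * m).factorial : ℝ) = 4 ^ m * m.factorial * (ascPochhammer ℝ m).eval (1 / 2) := by
  induction m with
  | zero => simp
  | succ m ih =>
    rw [ascPochhammer_succ_eval, show 2 * (m + 1) = 2 * m + 1 + 1 by ring,
      Nat.factorial_succ, Nat.factorial_succ, Nat.factorial_succ]
    push_cast
    rw [ih]
    ring

lemma factorial_two_mul_add_one_eq_ascPochhammer (m : ℕ) :
    ((2 * m + 1).factorial : ℝ) = 4 ^ m * m.factorial * (ascPochhammer ℝ m).eval (3 / 2) := by
  induction m with
  | zero => simp
  | succ m ih =>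
    rw [ascPochhammer_succ_eval, show 2 * (m + 1) + 1 = 2 * m + 1 + 1 + 1 by ring,
      Nat.factorial_succ (2 * m + 1 + 1), Nat.factorial_succ (2 * m + 1), Nat.factorial_succ m]
    push_cast
    rw [ih]
    ring

lemma integral_rpow_mul_exp_neg_mul_sq_Ioi {a s : ℝ} (ha : 0 < a) (hs : 0 < s) :
    ∫ x in Set.Ioi (0 : ℝ), x ^ (s - 1) * Real.exp (-a * x ^ 2)
      = a ^ (-(s / 2)) / 2 * Real.Gamma (s / 2) := by
  have h := integral_rpow_mul_exp_neg_mul_rpow (p := 2) (q := s - 1) (b := a)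
    two_pos (by linarith) ha
  simp only [Real.rpow_two, sub_add_cancel] at h
  rw [h, neg_div]
  ring

lemma integrableOn_rpow_mul_exp_neg_mul_sq_mul_exp {a s : ℝ} (ha : 0 < a) (hs : 0 < s) (c : ℝ) :
    IntegrableOn (fun x : ℝ ↦ x ^ (s - 1) * Real.exp (-a * x ^ 2) * Real.exp (c * x))
      (Set.Ioi 0) := by
  have hI : IntegrableOn (fun x : ℝ ↦ x ^ (s - 1) * Real.exp (-(a / 2) * x ^ 2)) (Set.Ioi 0) :=
    (integrable_rpow_mul_exp_neg_mul_sq (half_pos ha) (by linarith)).integrableOn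
  refine (hI.const_mul (Real.exp (c ^ 2 / (2 * a)))).mono' (by fun_prop) ?_
  refine (ae_restrict_iff' measurableSet_Ioi).mpr (ae_of_all _ fun x (hx : 0 < x) ↦ ?_)
  have hexp : -a * x ^ 2 + c * x ≤ c ^ 2 / (2 * a) + -(a / 2) * x ^ 2 := by
    have h : 0 ≤ a / 2 * (x - c / a) ^ 2 := by positivity
    have h' : a / 2 * (x - c / a) ^ 2 = a / 2 * x ^ 2 - c * x + c ^ 2 / (2 * a) := by
      field_simp
      ring
    linarith
  rw [Real.norm_of_nonneg (by positivity), mul_assoc, ← Real.exp_add, mul_left_comm,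
    ← Real.exp_add]
  gcongr

/-- Termwise integration of the exponential series against `x ^ (s - 1) * exp (-a * x ^ 2)`. -/
lemma hasSum_integral_rpow_mul_exp_neg_mul_sq_mul_exp {a s : ℝ} (ha : 0 < a) (hs : 0 < s)
    (c : ℝ) :
    HasSum (fun n : ℕ ↦ c ^ n / n.factorial *
        (a ^ (-((s + n) / 2)) / 2 * Real.Gamma ((s + n) / 2)))
      (∫ x in Set.Ioi (0 : ℝ), x ^ (s - 1) * Real.exp (-a * x ^ 2) * Real.exp (c * x)) := by
  have hexp (y : ℝ) : HasSum (fun n : ℕ ↦ y ^ n / n.factorial) (Real.exp y) := by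
    rw [Real.exp_eq_exp_ℝ]
    exact NormedSpace.expSeries_div_hasSum_exp y
  have hsum := hasSum_integral_of_dominated_convergence (μ := volume.restrict (Set.Ioi (0 : ℝ)))
    (F := fun (n : ℕ) x ↦ x ^ (s - 1) * Real.exp (-a * x ^ 2) * ((c * x) ^ n / n.factorial))
    (f := fun x ↦ x ^ (s - 1) * Real.exp (-a * x ^ 2) * Real.exp (c * x))
    (fun n x ↦ x ^ (s - 1) * Real.exp (-a * x ^ 2) * ((|c| * x) ^ n / n.factorial))
    (fun n ↦ by fun_prop) (fun n ↦ ?_) (ae_of_all _ fun x ↦ ((hexp _).mul_left _).summable) ?_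
    (ae_of_all _ fun x ↦ (hexp _).mul_left _)
  · refine hsum.congr_fun fun n ↦ ?_
    rw [← integral_rpow_mul_exp_neg_mul_sq_Ioi ha (by positivity), ← integral_const_mul]
    refine setIntegral_congr_fun measurableSet_Ioi fun x (hx : 0 < x) ↦ ?_
    rw [show s + n - 1 = s - 1 + n by ring, Real.rpow_add_natCast hx.ne', mul_pow]
    ring
  · refine (ae_restrict_iff' measurableSet_Ioi).mpr (ae_of_all _ fun x (hx : 0 < x) ↦ ?_)
    rw [norm_mul, Real.norm_of_nonneg (by positivity), norm_div, norm_pow, norm_mul,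
      Real.norm_eq_abs, Real.norm_of_nonneg hx.le, Real.norm_natCast]
  · simp only [((hexp _).mul_left _).tsum_eq]
    exact integrableOn_rpow_mul_exp_neg_mul_sq_mul_exp ha hs |c|

/-- If `X ~ Gamma(shape α > 0, rate κ > 0)` (law with density
`x ↦ κ^α x^(α−1) e^(−κx)/Γ(α)` on `(0,∞)`) and `a > 0`, then
`E[exp(−a X²)] = (κ^α/(2Γ(α))) a^(−α/2) [Γ(α/2) ₁F₁(α/2; 1/2; κ²/(4a))
  − (κ/√a) Γ((α+1)/2) ₁F₁((α+1)/2; 3/2; κ²/(4a))]`. -/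
theorem gamma_exp_square_mgf (α κ a : ℝ) (hα : 0 < α) (hκ : 0 < κ) (ha : 0 < a) :
    (∫ x in Set.Ioi (0 : ℝ),
        Real.exp (-a * x ^ 2) * (κ ^ α * x ^ (α - 1) * Real.exp (-κ * x) / Real.Gamma α))
      = (κ ^ α / (2 * Real.Gamma α)) * a ^ (-(α / 2)) *
          (Real.Gamma (α / 2) * oneFOne (α / 2) (1 / 2) (κ ^ 2 / (4 * a))
            - (κ / Real.sqrt a) * Real.Gamma ((α + 1) / 2) *
                oneFOne ((α + 1) / 2) (3 / 2) (κ ^ 2 / (4 * a))) := by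
  have hsum := hasSum_integral_rpow_mul_exp_neg_mul_sq_mul_exp ha hα (-κ)
  have heven : ∀ m : ℕ, (-κ) ^ (2 * m) / (2 * m).factorial *
      (a ^ (-((α + (2 * m : ℕ)) / 2)) / 2 * Real.Gamma ((α + (2 * m : ℕ)) / 2))
      = a ^ (-(α / 2)) / 2 * Real.Gamma (α / 2) *
        ((ascPochhammer ℝ m).eval (α / 2) / (ascPochhammer ℝ m).eval (1 / 2) *
          (κ ^ 2 / (4 * a)) ^ m / m.factorial) := by
    intro m
    have hP := ascPochhammer_pos m (1 / 2 : ℝ) (by norm_num)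
    rw [show (α + (2 * m : ℕ)) / 2 = α / 2 + m by push_cast; ring,
      Gamma_add_nat_eq_ascPochhammer (half_pos hα), factorial_two_mul_eq_ascPochhammer,
      neg_add, ← sub_eq_add_neg, Real.rpow_sub_natCast ha.ne', pow_mul, neg_sq, div_pow, mul_pow]
    field_simp
  have hodd : ∀ m : ℕ, (-κ) ^ (2 * m + 1) / (2 * m + 1).factorial *
      (a ^ (-((α + (2 * m + 1 : ℕ)) / 2)) / 2 * Real.Gamma ((α + (2 * m + 1 : ℕ)) / 2))
      = -(a ^ (-(α / 2)) / 2 * (κ / Real.sqrt a) * Real.Gamma ((α + 1) / 2)) *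
        ((ascPochhammer ℝ m).eval ((α + 1) / 2) / (ascPochhammer ℝ m).eval (3 / 2) *
          (κ ^ 2 / (4 * a)) ^ m / m.factorial) := by
    intro m
    have hP := ascPochhammer_pos m (3 / 2 : ℝ) (by norm_num)
    have hpow : a ^ (-((α + 1) / 2)) = a ^ (-(α / 2)) / Real.sqrt a := by
      rw [Real.sqrt_eq_rpow, ← Real.rpow_sub ha]
      ring_nf
    rw [show (α + (2 * m + 1 : ℕ)) / 2 = (α + 1) / 2 + m by push_cast; ring,
      Gamma_add_nat_eq_ascPochhammer (by positivity), factorial_two_mul_add_one_eq_ascPochhammer,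
      neg_add, ← sub_eq_add_neg, Real.rpow_sub_natCast ha.ne', hpow, pow_succ, pow_mul, neg_sq,
      div_pow, mul_pow]
    have := Real.sqrt_pos.mpr ha
    field_simp
  have hsplit := tsum_even_add_odd (f := fun n : ℕ ↦ (-κ) ^ n / n.factorial *
      (a ^ (-((α + n) / 2)) / 2 * Real.Gamma ((α + n) / 2)))
    (hsum.summable.comp_injective (mul_right_injective₀ (two_ne_zero' ℕ)))
    (hsum.summable.comp_injective
      ((add_left_injective 1).comp (mul_right_injective₀ (two_ne_zero' ℕ))))
  rw [hsum.tsum_eq, tsum_congr heven, tsum_congr hodd, tsum_mul_left, tsum_mul_left] at hsplit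
  have hint : (∫ x in Set.Ioi (0 : ℝ),
        Real.exp (-a * x ^ 2) * (κ ^ α * x ^ (α - 1) * Real.exp (-κ * x) / Real.Gamma α))
      = κ ^ α / Real.Gamma α *
        ∫ x in Set.Ioi (0 : ℝ), x ^ (α - 1) * Real.exp (-a * x ^ 2) * Real.exp (-κ * x) := by
    rw [← integral_const_mul]
    congr 1 with x
    ring
  rw [hint, ← hsplit, oneFOne, oneFOne]
  ring
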